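/- Let ℓ > 0 and α = 1/√2. Let M ≥ 1 and let x_1, …, x_N ∈ ℝ and w_1, …, w_N ∈ ℝ satisfy ∑_{m=1}^N |w_m| ≤ W for some W ≥ 0 and |x_m| ≤ 2·√M/β for all m. Then for every integer n ≥ 0: |∫_ℝ φ_n dμ − ∑_{m=1}^N w_m·φ_n(x_m)| ≤ 1 + K·√β·W·e^{M/β²}, with the constant K = 1.087. -/

import Mathlib

open MeasureTheory ProbabilityTheory

/-- Probabilists' Hermite polynomial evaluated at a real number. -/
noncomputable def H (n : ℕ) (x : ℝ) : ℝ := Polynomial.aeval x (Polynomial.hermite n)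

/-- The standard Gaussian measure on ℝ. -/
noncomputable def stdGauss : Measure ℝ := gaussianReal 0 1

theorem nonneg_of_hasDerivAt_of_zero {f f' : ℝ → ℝ} (hf : ∀ x, HasDerivAt f (f' x) x)
    (h0 : f 0 = 0) (hf' : ∀ x, 0 ≤ x → 0 ≤ f' x) {x : ℝ} (hx : 0 ≤ x) : 0 ≤ f x := by
  have hmono : MonotoneOn f (Set.Ici 0) := by
    refine monotoneOn_of_hasDerivWithinAt_nonneg (convex_Ici 0)
      (fun y _ ↦ (hf y).continuousAt.continuousWithinAt) (fun y _ ↦ (hf y).hasDerivWithinAt) ?_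
    intro y hy
    rw [interior_Ici] at hy
    exact hf' y hy.le
  simpa [h0] using hmono Set.self_mem_Ici (Set.mem_Ici.2 hx) hx

theorem cos_le_taylor_four {x : ℝ} (hx : 0 ≤ x) :
    Real.cos x ≤ 1 - x ^ 2 / 2 + x ^ 4 / 24 := by
  have h := nonneg_of_hasDerivAt_of_zero
    (f := fun y ↦ 1 - y ^ 2 / 2 + y ^ 4 / 24 - Real.cos y)
    (f' := fun y ↦ Real.sin y - (y - y ^ 3 / 6))
    (fun y ↦ by
      refine (((((hasDerivAt_id y).pow 2).div_const 2).const_sub 1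
        |>.add (((hasDerivAt_id y).pow 4).div_const 24)).sub (Real.hasDerivAt_cos y)).congr_deriv ?_
      simp
      ring)
    (by simp) (fun y hy ↦ sub_nonneg.2 (Real.sin_ge_sub_cube hy)) hx
  simpa using h

theorem sin_le_taylor_five {x : ℝ} (hx : 0 ≤ x) :
    Real.sin x ≤ x - x ^ 3 / 6 + x ^ 5 / 120 := by
  have h := nonneg_of_hasDerivAt_of_zero
    (f := fun y ↦ y - y ^ 3 / 6 + y ^ 5 / 120 - Real.sin y)
    (f' := fun y ↦ 1 - y ^ 2 / 2 + y ^ 4 / 24 - Real.cos y)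
    (fun y ↦ by
      refine ((((hasDerivAt_id y).sub (((hasDerivAt_id y).pow 3).div_const 6))
        |>.add (((hasDerivAt_id y).pow 5).div_const 120)).sub (Real.hasDerivAt_sin y)).congr_deriv ?_
      simp
      ring)
    (by simp) (fun y hy ↦ sub_nonneg.2 (cos_le_taylor_four hy)) hx
  simpa using h

theorem taylor_six_le_cos {x : ℝ} (hx : 0 ≤ x) :
    1 - x ^ 2 / 2 + x ^ 4 / 24 - x ^ 6 / 720 ≤ Real.cos x := by
  have h := nonneg_of_hasDerivAt_of_zero
    (f := fun y ↦ Real.cos y - (1 - y ^ 2 / 2 + y ^ 4 / 24 - y ^ 6 / 720))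
    (f' := fun y ↦ y - y ^ 3 / 6 + y ^ 5 / 120 - Real.sin y)
    (fun y ↦ by
      refine ((Real.hasDerivAt_cos y).sub (((((hasDerivAt_id y).pow 2).div_const 2).const_sub 1
        |>.add (((hasDerivAt_id y).pow 4).div_const 24)).sub
          (((hasDerivAt_id y).pow 6).div_const 720))).congr_deriv ?_
      simp
      ring)
    (by simp) (fun y hy ↦ sub_nonneg.2 (sin_le_taylor_five hy)) hx
  simpa using h

theorem taylor_seven_le_sin {x : ℝ} (hx : 0 ≤ x) :
    x - x ^ 3 / 6 + x ^ 5 / 120 - x ^ 7 / 5040 ≤ Real.sin x := by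
  have h := nonneg_of_hasDerivAt_of_zero
    (f := fun y ↦ Real.sin y - (y - y ^ 3 / 6 + y ^ 5 / 120 - y ^ 7 / 5040))
    (f' := fun y ↦ Real.cos y - (1 - y ^ 2 / 2 + y ^ 4 / 24 - y ^ 6 / 720))
    (fun y ↦ by
      refine ((Real.hasDerivAt_sin y).sub (((hasDerivAt_id y).sub
        (((hasDerivAt_id y).pow 3).div_const 6)
        |>.add (((hasDerivAt_id y).pow 5).div_const 120)).sub
          (((hasDerivAt_id y).pow 7).div_const 5040))).congr_deriv ?_
      simp
      ring)
    (by simp) (fun y hy ↦ sub_nonneg.2 (taylor_six_le_cos hy)) hx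
  simpa using h

/-- A polynomial majorant of `√(θ / sin θ)` in the variable `θ²`. -/
theorem le_sq_mul_sin {θ : ℝ} (h0 : 0 ≤ θ) (h1 : θ ≤ Real.pi / 2) :
    θ ≤ (1 + θ ^ 2 / 12 + θ ^ 4 / 160 + θ ^ 6 / 1000) ^ 2 * Real.sin θ := by
  have hs := taylor_seven_le_sin h0
  have hθ : θ ≤ 1.5708 := by linarith [Real.pi_lt_d4]
  have ht : θ ^ 2 ≤ 2.4675 := by nlinarith
  have ht0 : 0 ≤ θ ^ 2 := sq_nonneg θ
  have key : ∀ t : ℝ, 0 ≤ t → t ≤ 2.4675 →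
      1 ≤ (1 + t / 12 + t ^ 2 / 160 + t ^ 3 / 1000) ^ 2 *
        (1 - t / 6 + t ^ 2 / 120 - t ^ 3 / 5040) := by
    intro t h0 h1
    have h2 : t ≤ 5 / 2 := by linarith
    have t2 : t ^ 2 ≤ (5 / 2) ^ 2 := by gcongr
    have t4 : t ^ 4 ≤ (5 / 2) ^ 4 := by gcongr
    have t6 : t ^ 6 ≤ (5 / 2) ^ 6 := by gcongr
    have t3 : 0 ≤ t ^ 3 := by positivity
    have t5 : 0 ≤ t ^ 5 := by positivity
    have hpos : 0 ≤ t ^ 3 * (1499 / 1512000 - 463 / 2688000 * t - 31 / 103680000 * t ^ 2 +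
        667 / 24192000000 * t ^ 3 - 4999 / 48384000000 * t ^ 4 + 59 / 10080000000 * t ^ 5 -
        1 / 5040000000 * t ^ 6) := mul_nonneg t3 (by norm_num at *; linarith)
    linear_combination hpos
  calc θ = θ * 1 := by ring
    _ ≤ θ * ((1 + θ ^ 2 / 12 + (θ ^ 2) ^ 2 / 160 + (θ ^ 2) ^ 3 / 1000) ^ 2 *
        (1 - θ ^ 2 / 6 + (θ ^ 2) ^ 2 / 120 - (θ ^ 2) ^ 3 / 5040)) :=
      mul_le_mul_of_nonneg_left (key _ ht0 ht) h0
    _ = (1 + θ ^ 2 / 12 + θ ^ 4 / 160 + θ ^ 6 / 1000) ^ 2 *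
        (θ - θ ^ 3 / 6 + θ ^ 5 / 120 - θ ^ 7 / 5040) := by ring
    _ ≤ _ := mul_le_mul_of_nonneg_left hs (sq_nonneg _)

theorem Polynomial.derivative_hermite_succ (n : ℕ) :
    derivative (hermite (n + 1)) = ((n : Polynomial ℤ) + 1) * hermite n := by
  induction n with
  | zero => simp
  | succ n ih =>
    rw [hermite_succ (n + 1), derivative_sub, derivative_mul, derivative_X, ih, derivative_mul,
      hermite_succ n]
    simp
    ring

theorem H_zero (x : ℝ) : H 0 x = 1 := by simp [H]

theorem H_one (x : ℝ) : H 1 x = x := by simp [H]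

theorem H_add_two (n : ℕ) (x : ℝ) : H (n + 2) x = x * H (n + 1) x - (n + 1) * H n x := by
  simp only [H]
  rw [Polynomial.hermite_succ (n + 1), Polynomial.derivative_hermite_succ]
  simp

theorem hasDerivAt_H_succ (n : ℕ) (x : ℝ) : HasDerivAt (H (n + 1)) ((n + 1) * H n x) x := by
  have h := (Polynomial.hermite (n + 1)).hasDerivAt_aeval x
  rw [Polynomial.derivative_hermite_succ] at h
  refine h.congr_deriv ?_
  simp [H]

theorem integrable_aeval_mul_exp_neg_mul_sq (p : Polynomial ℝ) {b : ℝ} (hb : 0 < b) :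
    Integrable fun t : ℝ ↦ p.eval t * Real.exp (-b * t ^ 2) := by
  simp only [Polynomial.eval_eq_sum_range, Finset.sum_mul]
  refine integrable_finsetSum _ fun i _ ↦ ?_
  have h := (integrable_rpow_mul_exp_neg_mul_sq hb (s := (i : ℝ))
    (by have : (0 : ℝ) ≤ i := i.cast_nonneg
        linarith)).const_mul (p.coeff i)
  simpa [Real.rpow_natCast, mul_assoc] using h

theorem integrable_pow_mul_H_mul_exp (k n : ℕ) (c : ℝ) {b : ℝ} (hb : 0 < b) :
    Integrable fun t : ℝ ↦ t ^ k * H n (c * t) * Real.exp (-b * t ^ 2) := by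
  have h := integrable_aeval_mul_exp_neg_mul_sq (Polynomial.X ^ k *
    ((Polynomial.hermite n).map (Int.castRingHom ℝ)).comp (Polynomial.C c * Polynomial.X)) hb
  refine h.congr (.of_forall fun t ↦ ?_)
  simp [H, Polynomial.aeval_def, Polynomial.eval_map]

theorem integral_H_succ_mul_id_mul_exp (n : ℕ) (c : ℝ) {b : ℝ} (hb : 0 < b) :
    2 * b * ∫ t : ℝ, t * H (n + 1) (c * t) * Real.exp (-b * t ^ 2) =
      c * (n + 1) * ∫ t : ℝ, H n (c * t) * Real.exp (-b * t ^ 2) := by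
  have i0 : Integrable fun t : ℝ ↦ H n (c * t) * Real.exp (-b * t ^ 2) := by
    simpa using integrable_pow_mul_H_mul_exp 0 n c hb
  have i1 : Integrable fun t : ℝ ↦ t * H (n + 1) (c * t) * Real.exp (-b * t ^ 2) := by
    simpa using integrable_pow_mul_H_mul_exp 1 (n + 1) c hb
  have i2 : Integrable fun t : ℝ ↦ H (n + 1) (c * t) * Real.exp (-b * t ^ 2) := by
    simpa using integrable_pow_mul_H_mul_exp 0 (n + 1) c hb
  have hd : ∀ t : ℝ, HasDerivAt (fun t : ℝ ↦ H (n + 1) (c * t) * Real.exp (-b * t ^ 2))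
      (c * (n + 1) * (H n (c * t) * Real.exp (-b * t ^ 2)) -
        2 * b * (t * H (n + 1) (c * t) * Real.exp (-b * t ^ 2))) t := by
    intro t
    have h1 : HasDerivAt (fun t : ℝ ↦ c * t) c t := by
      simpa using (hasDerivAt_id t).const_mul c
    have h2 := (hasDerivAt_H_succ n (c * t)).comp t h1
    have h3 := (((hasDerivAt_id t).pow 2).const_mul (-b)).exp
    refine (h2.mul h3).congr_deriv ?_
    simp
    ring
  have h := integral_eq_zero_of_hasDerivAt_of_integrable hd
    ((i0.const_mul _).sub (i1.const_mul _)) i2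
  rw [integral_sub (i0.const_mul _) (i1.const_mul _), integral_const_mul, integral_const_mul] at h
  linarith

theorem integral_H_add_two_mul_exp (n : ℕ) (c : ℝ) {b : ℝ} (hb : 0 < b) :
    ∫ t : ℝ, H (n + 2) (c * t) * Real.exp (-b * t ^ 2) =
      (n + 1) * (c ^ 2 / (2 * b) - 1) * ∫ t : ℝ, H n (c * t) * Real.exp (-b * t ^ 2) := by
  have i0 : Integrable fun t : ℝ ↦ H n (c * t) * Real.exp (-b * t ^ 2) := by
    simpa using integrable_pow_mul_H_mul_exp 0 n c hb
  have i1 : Integrable fun t : ℝ ↦ t * H (n + 1) (c * t) * Real.exp (-b * t ^ 2) := by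
    simpa using integrable_pow_mul_H_mul_exp 1 (n + 1) c hb
  have hparts := integral_H_succ_mul_id_mul_exp n c hb
  have : ∀ t : ℝ, H (n + 2) (c * t) * Real.exp (-b * t ^ 2) =
      c * (t * H (n + 1) (c * t) * Real.exp (-b * t ^ 2)) -
        (n + 1) * (H n (c * t) * Real.exp (-b * t ^ 2)) := by
    intro t
    rw [H_add_two]
    ring
  simp_rw [this]
  rw [integral_sub (i1.const_mul _) (i0.const_mul _), integral_const_mul, integral_const_mul]
  set A := ∫ t : ℝ, t * H (n + 1) (c * t) * Real.exp (-b * t ^ 2)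
  set B := ∫ t : ℝ, H n (c * t) * Real.exp (-b * t ^ 2)
  field_simp
  linear_combination c * hparts

theorem integral_H_one_mul_exp (c b : ℝ) :
    ∫ t : ℝ, H 1 (c * t) * Real.exp (-b * t ^ 2) = 0 := by
  have h := integral_neg_eq_self (fun t : ℝ ↦ H 1 (c * t) * Real.exp (-b * t ^ 2)) volume
  have h2 : ∀ t : ℝ, H 1 (c * -t) * Real.exp (-b * (-t) ^ 2) =
      -(H 1 (c * t) * Real.exp (-b * t ^ 2)) := by
    intro t
    simp [H_one]
  simp_rw [h2, integral_neg] at h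
  linarith

theorem sq_integral_H_mul_exp_le (n : ℕ) (c : ℝ) {b : ℝ} (hb : 0 < b) (hc : c ^ 2 ≤ 4 * b) :
    (∫ t : ℝ, H n (c * t) * Real.exp (-b * t ^ 2)) ^ 2 ≤ n.factorial * (Real.pi / b) := by
  induction n using Nat.twoStepInduction with
  | zero =>
    simp only [H_zero, one_mul, integral_gaussian]
    rw [Real.sq_sqrt (by positivity)]
    simp
  | one =>
    rw [integral_H_one_mul_exp]
    have := Real.pi_pos
    rw [zero_pow two_ne_zero]
    positivity
  | more n ih _ =>
    rw [integral_H_add_two_mul_exp n c hb, mul_pow, mul_pow]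
    have h1 : (c ^ 2 / (2 * b) - 1) ^ 2 ≤ 1 := by
      have h2 : c ^ 2 / (2 * b) ≤ 2 := by
        rw [div_le_iff₀ (by positivity)]
        linarith
      have h3 : 0 ≤ c ^ 2 / (2 * b) := by positivity
      nlinarith
    have hfac : ((n + 2).factorial : ℝ) = (n + 2) * (n + 1) * n.factorial := by
      push_cast [Nat.factorial_succ]
      ring
    rw [hfac]
    calc ((n : ℝ) + 1) ^ 2 * (c ^ 2 / (2 * b) - 1) ^ 2 *
          (∫ t : ℝ, H n (c * t) * Real.exp (-b * t ^ 2)) ^ 2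
        ≤ ((n : ℝ) + 1) ^ 2 * 1 * (n.factorial * (Real.pi / b)) := by gcongr
      _ ≤ (n + 2) * (n + 1) * n.factorial * (Real.pi / b) := by
        have : (0 : ℝ) ≤ n.factorial * (Real.pi / b) * (n + 1) := by positivity
        nlinarith

theorem abs_integral_stdGauss_le_one (n : ℕ) {β : ℝ} (hβ : 1 ≤ β) :
    |∫ t, Real.sqrt (β / n.factorial) * Real.exp (-((β ^ 2 - 1) / 4) * t ^ 2) * H n (β * t)
      ∂stdGauss| ≤ 1 := by
  have hb : 0 < (β ^ 2 + 1) / 4 := by positivity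
  have hI := sq_integral_H_mul_exp_le n β hb (by linarith)
  have hfac : (0 : ℝ) < n.factorial := by exact_mod_cast n.factorial_pos
  have heq : ∫ t, Real.sqrt (β / n.factorial) * Real.exp (-((β ^ 2 - 1) / 4) * t ^ 2) * H n (β * t)
      ∂stdGauss = Real.sqrt (β / n.factorial) * (Real.sqrt (2 * Real.pi))⁻¹ *
        ∫ t : ℝ, H n (β * t) * Real.exp (-((β ^ 2 + 1) / 4) * t ^ 2) := by
    rw [stdGauss, integral_gaussianReal_eq_integral_smul one_ne_zero, ← integral_const_mul]
    refine integral_congr_ae (.of_forall fun t ↦ ?_)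
    have he : Real.exp (-((β ^ 2 + 1) / 4) * t ^ 2) =
        Real.exp (-((β ^ 2 - 1) / 4) * t ^ 2) * Real.exp (-t ^ 2 / 2) := by
      rw [← Real.exp_add]
      ring_nf
    simp only [gaussianPDFReal, smul_eq_mul, he]
    simp
    ring
  rw [heq, ← sq_le_one_iff_abs_le_one, mul_pow, mul_pow, inv_pow, Real.sq_sqrt (by positivity),
    Real.sq_sqrt (by positivity)]
  calc β / n.factorial * (2 * Real.pi)⁻¹ *
        (∫ t : ℝ, H n (β * t) * Real.exp (-((β ^ 2 + 1) / 4) * t ^ 2)) ^ 2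
      ≤ β / n.factorial * (2 * Real.pi)⁻¹ * (n.factorial * (Real.pi / ((β ^ 2 + 1) / 4))) := by
        gcongr
    _ = 2 * β / (β ^ 2 + 1) := by
        have := Real.pi_pos
        field_simp
        ring
    _ ≤ 1 := by
        rw [div_le_one (by positivity)]
        nlinarith [sq_nonneg (β - 1)]

theorem eq_sq_H_div_factorial_of_recurrence {y : ℝ} {d : ℕ → ℂ} (h0 : d 0 = 1)
    (h1 : d 1 = y ^ 2) (h2 : 2 * d 2 = (y ^ 2 - 1) * d 1 - (y ^ 2 - 1) * d 0)
    (hrec : ∀ n : ℕ, (n + 3) * d (n + 3) =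
      (y ^ 2 - (n + 2)) * d (n + 2) - (y ^ 2 - (n + 2)) * d (n + 1) + (n + 1) * d n) (n : ℕ) :
    d n = ((H n y ^ 2 / n.factorial : ℝ) : ℂ) := by
  suffices h : d n = ((H n y ^ 2 / n.factorial : ℝ) : ℂ) ∧
      d (n + 1) = ((H (n + 1) y ^ 2 / (n + 1).factorial : ℝ) : ℂ) ∧
      d (n + 2) = ((H (n + 2) y ^ 2 / (n + 2).factorial : ℝ) : ℂ) from h.1
  induction n with
  | zero =>
    refine ⟨by simp [h0, H_zero], by simp [h1, H_one], ?_⟩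
    rw [h1, h0] at h2
    rw [H_add_two, zero_add, H_one, H_zero]
    push_cast [Nat.factorial]
    linear_combination h2 / 2
  | succ n ih =>
    obtain ⟨e0, e1, e2⟩ := ih
    refine ⟨e1, e2, ?_⟩
    have hr := hrec n
    rw [e0, e1, e2] at hr
    have hn : (n + 3 : ℂ) ≠ 0 := by exact_mod_cast (n + 2).succ_ne_zero
    refine mul_left_cancel₀ hn (hr.trans ?_)
    rw [H_add_two (n + 1), H_add_two n]
    have hf : (n.factorial : ℝ) ≠ 0 := by exact_mod_cast n.factorial_ne_zero
    have h1 : (n + 1 : ℝ) ≠ 0 := by exact_mod_cast n.succ_ne_zero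
    have h2 : (n + 2 : ℝ) ≠ 0 := by exact_mod_cast (n + 1).succ_ne_zero
    have h3 : (n + 3 : ℝ) ≠ 0 := by exact_mod_cast (n + 2).succ_ne_zero
    have f1 : ((n + 1).factorial : ℝ) = (n + 1) * n.factorial := by
      push_cast [Nat.factorial_succ]; ring
    have f2 : ((n + 2).factorial : ℝ) = (n + 2) * ((n + 1) * n.factorial) := by
      push_cast [Nat.factorial_succ]; ring
    have f3 : ((n + 1 + 2).factorial : ℝ) = (n + 3) * ((n + 2) * ((n + 1) * n.factorial)) := by
      push_cast [Nat.factorial_succ]; ring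
    rw [f1, f2, f3]
    norm_cast
    push_cast
    field_simp
    ring

/-- The diagonal Mehler kernel, i.e. the generating function of `H n y ^ 2 / n!`. -/
noncomputable def mehler (y : ℝ) (z : ℂ) : ℂ :=
  Complex.exp (-(Complex.log (1 - z ^ 2) / 2) + y ^ 2 * (z / (1 + z)))

theorem one_sub_sq_mem_slitPlane {z : ℂ} (hz : ‖z‖ < 1) : 1 - z ^ 2 ∈ Complex.slitPlane := by
  have h : ‖-z ^ 2‖ < 1 := by
    rw [norm_neg, norm_pow]
    exact pow_lt_one₀ (norm_nonneg z) hz two_ne_zero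
  simpa [sub_eq_add_neg] using Complex.mem_slitPlane_of_norm_lt_one h

theorem one_add_ne_zero {z : ℂ} (hz : ‖z‖ < 1) : 1 + z ≠ 0 :=
  Complex.slitPlane_ne_zero (Complex.mem_slitPlane_of_norm_lt_one hz)

theorem hasDerivAt_mehler (y : ℝ) {z : ℂ} (hz : ‖z‖ < 1) :
    HasDerivAt (mehler y) (mehler y z * (z / (1 - z ^ 2) + y ^ 2 / (1 + z) ^ 2)) z := by
  have hs := one_sub_sq_mem_slitPlane hz
  have h1 := one_add_ne_zero hz
  have hlog := ((((hasDerivAt_id z).pow 2).const_sub 1).clog hs).div_const 2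
  have hquot := (((hasDerivAt_id z).div ((hasDerivAt_id z).const_add 1) h1).const_mul
    ((y : ℂ) ^ 2))
  refine (hlog.neg.add hquot).cexp.congr_deriv ?_
  have h2 := Complex.slitPlane_ne_zero hs
  simp only [mehler, id, Pi.pow_apply, Pi.add_apply, Pi.div_apply, Pi.neg_apply]
  congr 1
  field_simp
  simp
  ring

theorem hasDerivAt_mehler_mul_zpow (y : ℝ) (k : ℤ) {z : ℂ} (hz : ‖z‖ < 1) (h0 : z ≠ 0) :
    HasDerivAt (fun z ↦ mehler y z * ((1 - z ^ 2) * (1 + z)) * z ^ k)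
      (k * (mehler y z * z ^ (k - 1)) + (k + 1 + y ^ 2) * (mehler y z * z ^ k) -
        (k + 1 + y ^ 2) * (mehler y z * z ^ (k + 1)) - (k + 2) * (mehler y z * z ^ (k + 2))) z := by
  have hs := Complex.slitPlane_ne_zero (one_sub_sq_mem_slitPlane hz)
  have h1 := one_add_ne_zero hz
  have hpoly := (((hasDerivAt_id z).pow 2).const_sub 1).mul ((hasDerivAt_id z).const_add 1)
  refine (((hasDerivAt_mehler y hz).mul hpoly).mul (hasDerivAt_zpow k z (.inl h0))).congr_deriv ?_
  simp only [id, Pi.pow_apply, Pi.mul_apply]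
  rw [zpow_sub_one₀ h0, zpow_add_one₀ h0, zpow_add₀ h0]
  have hd : (1 - z ^ 2) * (1 + z) * (z / (1 - z ^ 2) + y ^ 2 / (1 + z) ^ 2) =
      z * (1 + z) + y ^ 2 * (1 - z) := by
    field_simp
    ring
  have hinv : z * z⁻¹ = 1 := mul_inv_cancel₀ h0
  simp only [zpow_ofNat, Nat.cast_ofNat, Nat.add_one_sub_one, pow_one, mul_one]
  linear_combination mehler y z * z ^ k * hd +
    mehler y z * k * z ^ k * (1 - z - z ^ 2) * hinv

theorem circleIntegral_mehler_mul_zpow_recurrence (y : ℝ) (k : ℤ) {r : ℝ} (hr0 : 0 < r)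
    (hr1 : r < 1) :
    k * (∮ z in C(0, r), mehler y z * z ^ (k - 1)) +
        (k + 1 + y ^ 2) * (∮ z in C(0, r), mehler y z * z ^ k) -
        (k + 1 + y ^ 2) * (∮ z in C(0, r), mehler y z * z ^ (k + 1)) -
        (k + 2) * (∮ z in C(0, r), mehler y z * z ^ (k + 2)) = 0 := by
  have hz1 : ∀ z ∈ Metric.sphere (0 : ℂ) r, ‖z‖ < 1 := fun z hz ↦ by
    rw [mem_sphere_zero_iff_norm.1 hz]
    exact hr1
  have hz0 : ∀ z ∈ Metric.sphere (0 : ℂ) r, z ≠ 0 := fun z hz ↦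
    norm_pos_iff.1 ((mem_sphere_zero_iff_norm.1 hz).symm ▸ hr0)
  have hi : ∀ j : ℤ, CircleIntegrable (fun z ↦ mehler y z * z ^ j) 0 r := fun j ↦
    ContinuousOn.circleIntegrable hr0.le fun z hz ↦
      ((hasDerivAt_mehler y (hz1 z hz)).continuousAt.mul
        (continuousAt_zpow₀ z j (.inl (hz0 z hz)))).continuousWithinAt
  have hic : ∀ (j : ℤ) (a : ℂ), CircleIntegrable (fun z ↦ a * (mehler y z * z ^ j)) 0 r :=
    fun j a ↦ (hi j).const_smul (a := a)
  have h := circleIntegral.integral_eq_zero_of_hasDerivWithinAt hr0.le fun z hz ↦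
    (hasDerivAt_mehler_mul_zpow y k (hz1 z hz) (hz0 z hz)).hasDerivWithinAt
  have hadd : CircleIntegrable (fun z ↦ k * (mehler y z * z ^ (k - 1)) +
      (k + 1 + y ^ 2) * (mehler y z * z ^ k)) 0 r := (hic _ _).add (hic _ _)
  have hsub : CircleIntegrable (fun z ↦ k * (mehler y z * z ^ (k - 1)) +
      (k + 1 + y ^ 2) * (mehler y z * z ^ k) -
      (k + 1 + y ^ 2) * (mehler y z * z ^ (k + 1))) 0 r := hadd.sub (hic _ _)
  rw [circleIntegral.integral_sub hsub (hic _ _), circleIntegral.integral_sub hadd (hic _ _),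
    circleIntegral.integral_add (hic _ _) (hic _ _)] at h
  simpa only [circleIntegral.integral_const_mul] using h

theorem circleIntegral_mehler_mul_zpow_neg (y : ℝ) (n : ℕ) {r : ℝ} (hr0 : 0 < r)
    (hr1 : r < 1) :
    (∮ z in C(0, r), mehler y z * z ^ (-(n : ℤ) - 1)) =
      2 * Real.pi * Complex.I * ((H n y ^ 2 / n.factorial : ℝ) : ℂ) := by
  have hz1 : ∀ z ∈ Metric.closedBall (0 : ℂ) r, ‖z‖ < 1 := fun z hz ↦
    (mem_closedBall_zero_iff.1 hz).trans_lt hr1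
  have hdiff : ∀ z ∈ Metric.closedBall (0 : ℂ) r, DifferentiableAt ℂ (mehler y) z := fun z hz ↦
    (hasDerivAt_mehler y (hz1 z hz)).differentiableAt
  have hpi : (2 * Real.pi * Complex.I : ℂ) ≠ 0 := Complex.two_pi_I_ne_zero
  have hnn : ∀ j : ℕ, (∮ z in C(0, r), mehler y z * z ^ (j : ℤ)) = 0 := fun j ↦ by
    simp only [zpow_natCast]
    have hd : ∀ z ∈ Metric.closedBall (0 : ℂ) r,
        DifferentiableAt ℂ (fun z ↦ mehler y z * z ^ j) z := fun z hz ↦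
      (hdiff z hz).mul (differentiableAt_pow j)
    exact Complex.circleIntegral_eq_zero_of_differentiable_on_off_countable hr0.le
      Set.countable_empty (fun z hz ↦ (hd z hz).continuousAt.continuousWithinAt)
      fun z hz ↦ hd z (Metric.ball_subset_closedBall hz.1)
  have hneg : (∮ z in C(0, r), mehler y z * z ^ (-1 : ℤ)) = 2 * Real.pi * Complex.I := by
    have h := Complex.circleIntegral_sub_center_inv_smul_of_differentiable_on_off_countable hr0
      Set.countable_empty (fun z hz ↦ (hdiff z hz).continuousAt.continuousWithinAt)
      fun z hz ↦ hdiff z (Metric.ball_subset_closedBall hz.1)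
    simpa [mehler, mul_comm] using h
  set D : ℤ → ℂ := fun k ↦ ∮ z in C(0, r), mehler y z * z ^ k with hD
  have hrec : ∀ k : ℤ, k * D (k - 1) + (k + 1 + y ^ 2) * D k - (k + 1 + y ^ 2) * D (k + 1) -
      (k + 2) * D (k + 2) = 0 := fun k ↦
    circleIntegral_mehler_mul_zpow_recurrence y k hr0 hr1
  have hD0 : D 0 = 0 := hnn 0
  have hD1 : D 1 = 0 := hnn 1
  have hDm : D (-1) = 2 * Real.pi * Complex.I := hneg
  have h := eq_sq_H_div_factorial_of_recurrence (y := y)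
    (d := fun n ↦ D (-(n : ℤ) - 1) / (2 * Real.pi * Complex.I)) ?_ ?_ ?_ ?_ n
  · rw [← h]
    exact (mul_div_cancel₀ _ hpi).symm
  · simp [hDm, hpi]
  · have h := hrec (-1)
    norm_num [hD0, hD1, hDm] at h ⊢
    rw [div_eq_iff hpi]
    linear_combination -h
  · have h := hrec (-2)
    norm_num [hD0] at h ⊢
    field_simp
    linear_combination -h
  · intro m
    have h := hrec (-(m : ℤ) - 3)
    have e1 : (-(m : ℤ) - 3) - 1 = -((m + 3 : ℕ) : ℤ) - 1 := by push_cast; ring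
    have e2 : (-(m : ℤ) - 3) = -((m + 2 : ℕ) : ℤ) - 1 := by push_cast; ring
    have e3 : (-(m : ℤ) - 3) + 1 = -((m + 1 : ℕ) : ℤ) - 1 := by push_cast; ring
    have e4 : (-(m : ℤ) - 3) + 2 = -(m : ℤ) - 1 := by ring
    rw [e1, e3, e4] at h
    have e5 : D (-(m : ℤ) - 3) = D (-((m + 2 : ℕ) : ℤ) - 1) := by rw [e2]
    rw [e5] at h
    field_simp
    push_cast at h ⊢
    linear_combination -h

theorem re_div_one_add_le {z : ℂ} (hz : ‖z‖ < 1) : (z / (1 + z)).re ≤ 1 / 2 := by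
  have h1 := one_add_ne_zero hz
  have hsq : z.re * z.re + z.im * z.im < 1 := by
    rw [← Complex.normSq_apply, Complex.normSq_eq_norm_sq]
    exact pow_lt_one₀ (norm_nonneg z) hz two_ne_zero
  have hpos : 0 < Complex.normSq (1 + z) := Complex.normSq_pos.2 h1
  rw [Complex.div_re, ← add_div, div_le_iff₀ hpos, Complex.normSq_apply]
  simp
  nlinarith

theorem norm_mehler_le (y : ℝ) {z : ℂ} (hz : ‖z‖ < 1) :
    ‖mehler y z‖ ≤ Real.exp (y ^ 2 / 2) * ‖1 - z ^ 2‖ ^ (-(1 / 2) : ℝ) := by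
  have hpos : 0 < ‖1 - z ^ 2‖ :=
    norm_pos_iff.2 (Complex.slitPlane_ne_zero (one_sub_sq_mem_slitPlane hz))
  rw [mehler, Complex.norm_exp, Real.rpow_def_of_pos hpos, ← Real.exp_add, Real.exp_le_exp]
  have h2 : (Complex.log (1 - z ^ 2) / 2).re = Real.log ‖1 - z ^ 2‖ / 2 := by
    rw [Complex.div_ofNat_re, Complex.log_re]
  have h3 : ((y : ℂ) ^ 2 * (z / (1 + z))).re = y ^ 2 * (z / (1 + z)).re := by
    rw [← Complex.ofReal_pow, Complex.re_ofReal_mul]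
  rw [Complex.add_re, Complex.neg_re, h2, h3]
  nlinarith [mul_le_mul_of_nonneg_left (re_div_one_add_le hz) (sq_nonneg y)]

theorem norm_one_sub_circleMap_sq (r θ : ℝ) :
    ‖1 - circleMap 0 r θ ^ 2‖ ^ (-(1 / 2) : ℝ) =
      ((1 - r ^ 2) ^ 2 + 4 * r ^ 2 * Real.sin θ ^ 2) ^ (-(1 / 4) : ℝ) := by
  have h : (1 - r ^ 2) ^ 2 + 4 * r ^ 2 * Real.sin θ ^ 2 = ‖1 - circleMap 0 r θ ^ 2‖ ^ 2 := by
    rw [← Complex.normSq_eq_norm_sq, Complex.normSq_apply]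
    have hc := Real.sin_sq_add_cos_sq θ
    simp only [circleMap, zero_add, Complex.exp_mul_I]
    simp [pow_two, Complex.cos_ofReal_re, Complex.sin_ofReal_re]
    have hc' : Real.cos θ ^ 2 = 1 - Real.sin θ ^ 2 := by linarith
    ring_nf
    rw [show Real.cos θ ^ 4 = (Real.cos θ ^ 2) ^ 2 by ring, hc']
    ring
  rw [h, ← Real.rpow_natCast, ← Real.rpow_mul (norm_nonneg _)]
  norm_num

theorem kernel_base_pos {r : ℝ} (hr0 : 0 < r) (hr1 : r < 1) (θ : ℝ) :
    0 < (1 - r ^ 2) ^ 2 + 4 * r ^ 2 * Real.sin θ ^ 2 := by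
  have : 0 < 1 - r ^ 2 := sub_pos.2 (pow_lt_one₀ hr0.le hr1 two_ne_zero)
  positivity

theorem continuous_kernel {r : ℝ} (hr0 : 0 < r) (hr1 : r < 1) :
    Continuous fun θ : ℝ ↦ ((1 - r ^ 2) ^ 2 + 4 * r ^ 2 * Real.sin θ ^ 2) ^ (-(1 / 4) : ℝ) :=
  Continuous.rpow_const (by fun_prop) fun θ ↦ .inl (kernel_base_pos hr0 hr1 θ).ne'

theorem intervalIntegral_two_pi_eq_four_mul {f : ℝ → ℝ} (hf : Continuous f)
    (h1 : ∀ θ, f (θ + Real.pi) = f θ) (h2 : ∀ θ, f (Real.pi - θ) = f θ) :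
    ∫ θ in 0..2 * Real.pi, f θ = 4 * ∫ θ in 0..Real.pi / 2, f θ := by
  have hi : ∀ a b, IntervalIntegrable f volume a b := fun a b ↦ hf.intervalIntegrable a b
  have e1 : ∫ θ in Real.pi..2 * Real.pi, f θ = ∫ θ in 0..Real.pi, f θ := by
    have h := intervalIntegral.integral_comp_add_right (a := 0) (b := Real.pi) f Real.pi
    simp_rw [h1] at h
    rw [h]
    ring_nf
  have e2 : ∫ θ in Real.pi / 2..Real.pi, f θ = ∫ θ in 0..Real.pi / 2, f θ := by
    have h := intervalIntegral.integral_comp_sub_left (a := 0) (b := Real.pi / 2) f Real.pi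
    simp_rw [h2] at h
    rw [h]
    ring_nf
  rw [← intervalIntegral.integral_add_adjacent_intervals (hi 0 Real.pi) (hi Real.pi _), e1,
    ← intervalIntegral.integral_add_adjacent_intervals (hi 0 (Real.pi / 2)) (hi _ Real.pi), e2]
  ring

theorem kernel_le {r θ : ℝ} (hr0 : 0 < r) (hθ0 : 0 < θ) (hθ1 : θ ≤ Real.pi / 2) :
    ((1 - r ^ 2) ^ 2 + 4 * r ^ 2 * Real.sin θ ^ 2) ^ (-(1 / 4) : ℝ) ≤
      (Real.sqrt (2 * r))⁻¹ * (θ ^ (-(1 / 2) : ℝ) + θ ^ (3 / 2 : ℝ) / 12 +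
        θ ^ (7 / 2 : ℝ) / 160 + θ ^ (11 / 2 : ℝ) / 1000) := by
  set p := 1 + θ ^ 2 / 12 + θ ^ 4 / 160 + θ ^ 6 / 1000 with hp
  have hp0 : 0 < p := by positivity
  have hq : 0 < 2 * r * θ / p ^ 2 := by positivity
  have hsin : 2 * r * θ / p ^ 2 ≤ 2 * r * Real.sin θ := by
    rw [div_le_iff₀ (by positivity)]
    linear_combination 2 * r * le_sq_mul_sin hθ0.le hθ1
  have hbase : (2 * r * θ / p ^ 2) ^ 2 ≤ (1 - r ^ 2) ^ 2 + 4 * r ^ 2 * Real.sin θ ^ 2 := by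
    nlinarith [pow_le_pow_left₀ hq.le hsin 2, sq_nonneg (1 - r ^ 2)]
  refine (Real.rpow_le_rpow_of_nonpos (by positivity) hbase (by norm_num)).trans_eq ?_
  have hpow : ∀ (s : ℝ) (k : ℕ), s = -(1 / 2) + k →
      θ ^ s = θ ^ (-(1 / 2) : ℝ) * θ ^ k := fun s k h ↦ by
    rw [h, Real.rpow_add_natCast hθ0.ne']
  rw [hpow (3 / 2) 2 (by norm_num), hpow (7 / 2) 4 (by norm_num), hpow (11 / 2) 6 (by norm_num),
    ← Real.rpow_natCast, ← Real.rpow_mul hq.le,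
    show ((2 : ℕ) : ℝ) * -(1 / 4) = -(1 / 2) by norm_num, Real.div_rpow (by positivity)
      (by positivity), Real.mul_rpow (by positivity) hθ0.le, ← Real.rpow_natCast p 2,
    ← Real.rpow_mul hp0.le, show ((2 : ℕ) : ℝ) * -(1 / 2) = -1 by norm_num, Real.rpow_neg_one,
    Real.rpow_neg (by positivity) (1 / 2), ← Real.sqrt_eq_rpow, hp]
  field_simp

theorem intervalIntegrable_majorant (a b : ℝ) : IntervalIntegrable
    (fun θ : ℝ ↦ θ ^ (-(1 / 2) : ℝ) + θ ^ (3 / 2 : ℝ) / 12 + θ ^ (7 / 2 : ℝ) / 160 +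
      θ ^ (11 / 2 : ℝ) / 1000) volume a b := by
  have hi : ∀ s : ℝ, -1 < s → IntervalIntegrable (fun θ : ℝ ↦ θ ^ s) volume a b := fun s hs ↦
    intervalIntegral.intervalIntegrable_rpow' hs
  exact (((hi _ (by norm_num)).add ((hi _ (by norm_num)).div_const _)).add
    ((hi _ (by norm_num)).div_const _)).add ((hi _ (by norm_num)).div_const _)

theorem integral_majorant {h : ℝ} (hh : 0 < h) :
    ∫ θ in 0..h, (θ ^ (-(1 / 2) : ℝ) + θ ^ (3 / 2 : ℝ) / 12 + θ ^ (7 / 2 : ℝ) / 160 +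
      θ ^ (11 / 2 : ℝ) / 1000) =
      Real.sqrt h * (2 + h ^ 2 / 30 + h ^ 4 / 720 + h ^ 6 / 6500) := by
  have hi : ∀ s : ℝ, -1 < s → IntervalIntegrable (fun θ : ℝ ↦ θ ^ s) volume 0 h := fun s hs ↦
    intervalIntegral.intervalIntegrable_rpow' hs
  have i0 := hi (-(1 / 2)) (by norm_num)
  have i1 := (hi (3 / 2) (by norm_num)).div_const 12
  have i2 := (hi (7 / 2) (by norm_num)).div_const 160
  have i3 := (hi (11 / 2) (by norm_num)).div_const 1000
  have hpow : ∀ (s : ℝ) (k : ℕ), s = 1 / 2 + k → h ^ s = Real.sqrt h * h ^ k := fun s k e ↦ by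
    rw [e, Real.rpow_add_natCast hh.ne', Real.sqrt_eq_rpow]
  have hI : ∀ (s : ℝ) (k : ℕ), s = -(1 / 2) + k →
      ∫ θ in 0..h, θ ^ s = Real.sqrt h * h ^ k / (k + 1 / 2) := fun s k e ↦ by
    have hk : (0 : ℝ) ≤ k := k.cast_nonneg
    have hs : s + 1 ≠ 0 := by linarith
    rw [integral_rpow (.inl (by linarith)), Real.zero_rpow hs, sub_zero,
      hpow (s + 1) k (by linarith)]
    congr 1
    linarith
  rw [intervalIntegral.integral_add ((i0.add i1).add i2) i3,
    intervalIntegral.integral_add (i0.add i1) i2, intervalIntegral.integral_add i0 i1]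
  simp only [intervalIntegral.integral_div]
  rw [hI _ 0 (by norm_num), hI (3 / 2) 2 (by norm_num), hI (7 / 2) 4 (by norm_num),
    hI (11 / 2) 6 (by norm_num)]
  norm_num
  ring

theorem integral_kernel_le {r : ℝ} (hr0 : 0 < r) (hr1 : r < 1) :
    ∫ θ in 0..2 * Real.pi,
      ((1 - r ^ 2) ^ 2 + 4 * r ^ 2 * Real.sin θ ^ 2) ^ (-(1 / 4) : ℝ) ≤
      2 * Real.pi * 1.087 ^ 2 * (Real.sqrt r)⁻¹ := by
  have hπ := Real.pi_pos
  rw [intervalIntegral_two_pi_eq_four_mul (continuous_kernel hr0 hr1) (by simp) (by simp)]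
  have hle : ∫ θ in 0..Real.pi / 2,
      ((1 - r ^ 2) ^ 2 + 4 * r ^ 2 * Real.sin θ ^ 2) ^ (-(1 / 4) : ℝ) ≤
      (Real.sqrt (2 * r))⁻¹ * (Real.sqrt (Real.pi / 2) * (2 + (Real.pi / 2) ^ 2 / 30 +
        (Real.pi / 2) ^ 4 / 720 + (Real.pi / 2) ^ 6 / 6500)) := by
    rw [← integral_majorant (by positivity), ← intervalIntegral.integral_const_mul]
    exact intervalIntegral.integral_mono_on_of_le_Ioo (by positivity)
      ((continuous_kernel hr0 hr1).intervalIntegrable _ _)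
      ((intervalIntegrable_majorant _ _).const_mul _)
      fun θ hθ ↦ kernel_le hr0 hθ.1 hθ.2.le
  have hS : 2 + (Real.pi / 2) ^ 2 / 30 + (Real.pi / 2) ^ 4 / 720 + (Real.pi / 2) ^ 6 / 6500 ≤
      1.087 ^ 2 * Real.sqrt Real.pi := by
    have hu : Real.pi / 2 ≤ 1.5708 := by linarith [Real.pi_lt_d4]
    calc 2 + (Real.pi / 2) ^ 2 / 30 + (Real.pi / 2) ^ 4 / 720 + (Real.pi / 2) ^ 6 / 6500
        ≤ 2 + 1.5708 ^ 2 / 30 + 1.5708 ^ 4 / 720 + 1.5708 ^ 6 / 6500 := by gcongr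
      _ ≤ 1.087 ^ 2 * 1.7724 := by norm_num
      _ ≤ 1.087 ^ 2 * Real.sqrt Real.pi := by
        gcongr
        exact Real.le_sqrt_of_sq_le (by norm_num; linarith [Real.pi_gt_d4])
  have hsq : Real.sqrt (Real.pi / 2) * Real.sqrt Real.pi = Real.pi / Real.sqrt 2 := by
    rw [Real.sqrt_div hπ.le, div_mul_eq_mul_div, Real.mul_self_sqrt hπ.le]
  have h2 : Real.sqrt 2 * Real.sqrt 2 = 2 := Real.mul_self_sqrt (by norm_num)
  calc _ ≤ 4 * ((Real.sqrt (2 * r))⁻¹ * (Real.sqrt (Real.pi / 2) *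
        (1.087 ^ 2 * Real.sqrt Real.pi))) := by
        refine mul_le_mul_of_nonneg_left (hle.trans ?_) (by norm_num)
        gcongr
    _ = 4 * 1.087 ^ 2 * (Real.sqrt (2 * r))⁻¹ *
        (Real.sqrt (Real.pi / 2) * Real.sqrt Real.pi) := by ring
    _ = 4 * 1.087 ^ 2 * (Real.sqrt r)⁻¹ * Real.pi / (Real.sqrt 2 * Real.sqrt 2) := by
        rw [hsq, Real.sqrt_mul (by norm_num)]
        have : Real.sqrt r ≠ 0 := (Real.sqrt_pos.2 hr0).ne'
        field_simp
    _ = _ := by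
        rw [h2]
        ring

theorem norm_circleIntegral_mehler_le (y : ℝ) (n : ℕ) {r : ℝ} (hr0 : 0 < r) (hr1 : r < 1) :
    ‖∮ z in C(0, r), mehler y z * z ^ (-(n : ℤ) - 1)‖ ≤
      (r ^ n)⁻¹ * Real.exp (y ^ 2 / 2) * (2 * Real.pi * 1.087 ^ 2 * (Real.sqrt r)⁻¹) := by
  have hnorm : ∀ θ, ‖circleMap 0 r θ‖ = r := fun θ ↦ by simp [abs_of_pos hr0]
  have hbound : ∀ θ, ‖deriv (circleMap 0 r) θ • (mehler y (circleMap 0 r θ) *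
      circleMap 0 r θ ^ (-(n : ℤ) - 1))‖ ≤ (r ^ n)⁻¹ * Real.exp (y ^ 2 / 2) *
        ((1 - r ^ 2) ^ 2 + 4 * r ^ 2 * Real.sin θ ^ 2) ^ (-(1 / 4) : ℝ) := by
    intro θ
    have hm := norm_mehler_le y ((hnorm θ).trans_lt hr1)
    rw [norm_one_sub_circleMap_sq] at hm
    rw [deriv_circleMap, norm_smul, norm_mul, norm_mul, norm_zpow, hnorm, Complex.norm_I,
      zpow_sub_one₀ hr0.ne', zpow_neg, zpow_natCast]
    calc r * 1 * (‖mehler y (circleMap 0 r θ)‖ * ((r ^ n)⁻¹ * r⁻¹))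
        = (r ^ n)⁻¹ * ‖mehler y (circleMap 0 r θ)‖ := by field_simp
      _ ≤ _ := by
        rw [mul_assoc]
        gcongr
  refine (intervalIntegral.norm_integral_le_of_norm_le Real.two_pi_pos.le
    (.of_forall fun θ _ ↦ hbound θ)
    (((continuous_kernel hr0 hr1).const_mul _).intervalIntegrable _ _)).trans ?_
  rw [intervalIntegral.integral_const_mul]
  exact mul_le_mul_of_nonneg_left (integral_kernel_le hr0 hr1) (by positivity)

theorem sq_H_div_factorial_le (n : ℕ) (y : ℝ) :
    H n y ^ 2 / n.factorial ≤ 1.087 ^ 2 * Real.exp (y ^ 2 / 2) := by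
  have hπ := Real.pi_pos
  have hr : ∀ r : ℝ, 0 < r → r < 1 →
      r ^ n * Real.sqrt r * (H n y ^ 2 / n.factorial) ≤ 1.087 ^ 2 * Real.exp (y ^ 2 / 2) := by
    intro r hr0 hr1
    have h := norm_circleIntegral_mehler_le y n hr0 hr1
    have hs : 0 < Real.sqrt r := Real.sqrt_pos.2 hr0
    have hnn : 0 ≤ H n y ^ 2 / n.factorial := by positivity
    rw [circleIntegral_mehler_mul_zpow_neg y n hr0 hr1, norm_mul, Complex.norm_real,
      Real.norm_of_nonneg hnn] at h
    have hc : ‖(2 * Real.pi * Complex.I : ℂ)‖ = 2 * Real.pi := by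
      simp [abs_of_pos hπ]
    rw [hc] at h
    have hpos : 0 < r ^ n * Real.sqrt r / (2 * Real.pi) := by positivity
    calc r ^ n * Real.sqrt r * (H n y ^ 2 / n.factorial)
        = r ^ n * Real.sqrt r / (2 * Real.pi) * (2 * Real.pi * (H n y ^ 2 / n.factorial)) := by
          field_simp
      _ ≤ _ := mul_le_mul_of_nonneg_left h hpos.le
      _ = 1.087 ^ 2 * Real.exp (y ^ 2 / 2) := by
          field_simp
  have hcont : Filter.Tendsto (fun r : ℝ ↦ r ^ n * Real.sqrt r * (H n y ^ 2 / n.factorial))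
      (nhdsWithin 1 (Set.Iio 1)) (nhds (1 ^ n * Real.sqrt 1 * (H n y ^ 2 / n.factorial))) :=
    (Continuous.tendsto (by fun_prop) 1).mono_left nhdsWithin_le_nhds
  have h := le_of_tendsto hcont
    (Filter.eventually_of_mem (Ioo_mem_nhdsLT zero_lt_one) fun r h ↦ hr r h.1 h.2)
  simpa using h

/-- **Cramér's inequality** for the probabilists' Hermite polynomials. -/
theorem abs_H_le (n : ℕ) (y : ℝ) :
    |H n y| ≤ 1.087 * Real.sqrt n.factorial * Real.exp (y ^ 2 / 4) := by
  have hf : (0 : ℝ) < n.factorial := by exact_mod_cast n.factorial_pos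
  refine abs_le_of_sq_le_sq ?_ (by positivity)
  rw [mul_pow, mul_pow, Real.sq_sqrt hf.le, ← Real.exp_nat_mul]
  have h := sq_H_div_factorial_le n y
  rw [div_le_iff₀ hf] at h
  have e : ((2 : ℕ) : ℝ) * (y ^ 2 / 4) = y ^ 2 / 2 := by
    push_cast
    ring
  rw [e]
  linarith

theorem stmt_14 (ℓ α : ℝ) (hℓ : 0 < ℓ) (hα : α = 1 / Real.sqrt 2)
    (ε β δ2 : ℝ)
    (hε : ε = 1 / (Real.sqrt 2 * ℓ))
    (hβ : β = (1 + (2 * ε / α) ^ 2) ^ ((1 : ℝ) / 4))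
    (hδ2 : δ2 = α ^ 2 * (β ^ 2 - 1) / 2)
    (φ : ℕ → ℝ → ℝ)
    (hφ : ∀ n x, φ n x = Real.sqrt (β / (n.factorial : ℝ)) * Real.exp (-δ2 * x ^ 2) *
      H n (Real.sqrt 2 * α * β * x))
    (M N : ℕ) (hM : 1 ≤ M)
    (x w : Fin N → ℝ) (W : ℝ) (hW : 0 ≤ W)
    (hw : ∑ m, |w m| ≤ W)
    (hx : ∀ m, |x m| ≤ 2 * Real.sqrt M / β)
    (n : ℕ) :
    |(∫ t, φ n t ∂stdGauss) - ∑ m, w m * φ n (x m)| ≤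
      1 + 1.087 * Real.sqrt β * W * Real.exp ((M : ℝ) / β ^ 2) := by
  have hβ1 : 1 ≤ β := by
    rw [hβ]
    exact Real.one_le_rpow (by linarith [sq_nonneg (2 * ε / α)]) (by norm_num)
  have hβ0 : 0 < β := by linarith
  have hα2 : α ^ 2 = 1 / 2 := by
    rw [hα, div_pow, Real.sq_sqrt (by norm_num)]
    norm_num
  have hα1 : Real.sqrt 2 * α = 1 := by
    rw [hα]
    field_simp
  have hδ : δ2 = (β ^ 2 - 1) / 4 := by
    rw [hδ2, hα2]
    ring
  simp only [hα1, one_mul, hδ] at hφ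
  have hint : |∫ t, φ n t ∂stdGauss| ≤ 1 := by
    simp_rw [hφ]
    exact abs_integral_stdGauss_le_one n hβ1
  have hfac : (0 : ℝ) < n.factorial := by exact_mod_cast n.factorial_pos
  have hpt : ∀ m, |φ n (x m)| ≤ 1.087 * Real.sqrt β * Real.exp ((M : ℝ) / β ^ 2) := by
    intro m
    have hsq : x m ^ 2 / 4 ≤ (M : ℝ) / β ^ 2 := by
      have h := pow_le_pow_left₀ (abs_nonneg _) (hx m) 2
      rw [sq_abs, div_pow, mul_pow, Real.sq_sqrt M.cast_nonneg] at h
      calc x m ^ 2 / 4 ≤ 2 ^ 2 * M / β ^ 2 / 4 := by gcongr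
        _ = (M : ℝ) / β ^ 2 := by ring
    rw [hφ, abs_mul, abs_mul, abs_of_nonneg (Real.sqrt_nonneg _), abs_of_pos (Real.exp_pos _)]
    calc Real.sqrt (β / n.factorial) * Real.exp (-((β ^ 2 - 1) / 4) * x m ^ 2) * |H n (β * x m)|
        ≤ Real.sqrt (β / n.factorial) * Real.exp (-((β ^ 2 - 1) / 4) * x m ^ 2) *
          (1.087 * Real.sqrt n.factorial * Real.exp ((β * x m) ^ 2 / 4)) := by
          gcongr
          exact abs_H_le n _
      _ = 1.087 * (Real.sqrt (β / n.factorial) * Real.sqrt n.factorial) *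
          (Real.exp (-((β ^ 2 - 1) / 4) * x m ^ 2) * Real.exp ((β * x m) ^ 2 / 4)) := by ring
      _ = 1.087 * Real.sqrt β * Real.exp (x m ^ 2 / 4) := by
          rw [← Real.sqrt_mul (by positivity), div_mul_cancel₀ _ hfac.ne', ← Real.exp_add]
          ring_nf
      _ ≤ _ := by gcongr
  have hsum : |∑ m, w m * φ n (x m)| ≤
      1.087 * Real.sqrt β * W * Real.exp ((M : ℝ) / β ^ 2) := by
    calc |∑ m, w m * φ n (x m)| ≤ ∑ m, |w m * φ n (x m)| := Finset.abs_sum_le_sum_abs _ _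
      _ ≤ ∑ m, |w m| * (1.087 * Real.sqrt β * Real.exp ((M : ℝ) / β ^ 2)) := by
          refine Finset.sum_le_sum fun m _ ↦ ?_
          rw [abs_mul]
          exact mul_le_mul_of_nonneg_left (hpt m) (abs_nonneg _)
      _ = (∑ m, |w m|) * (1.087 * Real.sqrt β * Real.exp ((M : ℝ) / β ^ 2)) := by
          rw [Finset.sum_mul]
      _ ≤ W * (1.087 * Real.sqrt β * Real.exp ((M : ℝ) / β ^ 2)) := by gcongr
      _ = _ := by ring
  calc _ ≤ |∫ t, φ n t ∂stdGauss| + |∑ m, w m * φ n (x m)| := abs_sub _ _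
    _ ≤ _ := add_le_add hint hsum
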